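/- arXiv:2510.01630 — 7 statements merged into one kernel-verified Lean document; each statement's English description precedes it below -/
import Mathlib

section
/- Let k ≥ 1 and d ≥ 1 be integers and let μ_k = {z ∈ ℂ : z^k = 1} be the set of k-th roots of unity. There exists a polynomial Q ∈ ℤ[X_1,…,X_d] with integer coefficients, homogeneous of total degree k^{d−1}, such that for every tuple (r_1,…,r_d) of complex numbers one has ∏_{(w_1,…,w_d) ∈ μ_k^d} (w_1·r_1 + ⋯ + w_d·r_d) = Q(r_1^k, …, r_d^k). (Consequently, for nonzero complex numbers R_1,…,R_d, the product of the sums r_1+⋯+r_d taken over all tuples of k-th roots r_i of R_i is a homogeneous polynomial of degree k^{d−1} with integer coefficients in R_1,…,R_d.) -/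
open Polynomial in
/-- If `F` has coefficients in the image of `φ : A →+* B` and so does `y ^ k`, then the product of the
translates of `F` by `ζ ^ i * y` again has coefficients in the image of `φ`: it is the image of a
resultant. -/
lemma prod_taylor_mem_lifts {A B : Type*} [CommRing A] [CommRing B] [IsDomain B] (φ : A →+* B)
    {k : ℕ} (hk : 0 < k) {ζ : B} (hζ : IsPrimitiveRoot ζ k) {F : B[X]} (hF : F ∈ lifts φ)
    {y : B} (hy : y ^ k ∈ φ.range) :
    ∏ i ∈ Finset.range k, taylor (ζ ^ i * y) F ∈ lifts φ := by
  obtain ⟨F, rfl⟩ := (mem_lifts _).1 hF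
  obtain ⟨a, ha⟩ := hy
  let G : A[X][X] := taylor X (F.map C)
  let f : A[X][X] := X ^ k - C (C a)
  refine (mem_lifts _).2 ⟨f.resultant G k G.natDegree, ?_⟩
  have hfac : f.map (mapRingHom φ) =
      ∏ i ∈ Finset.range k, (X - C (C (ζ ^ i * y))) := by
    have h := X_pow_sub_C_eq_prod (hζ.map_of_injective (C_injective (R := B))) hk
      (α := C y) (a := C (y ^ k)) (by simp)
    simpa [f, ha] using h
  have hdeg : (∏ i ∈ Finset.range k, (X - C (C (ζ ^ i * y)) : B[X][X])).natDegree = k := by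
    rw [natDegree_prod_of_monic _ _ fun i _ => monic_X_sub_C _]
    simp only [natDegree_X_sub_C]
    simp
  have hG : (G.map (mapRingHom φ)).natDegree ≤ G.natDegree := natDegree_map_le
  rw [← coe_mapRingHom, ← resultant_map_map, hfac]
  have h := resultant_prod_left (Finset.range k) (fun i => (X - C (C (ζ ^ i * y)) : B[X][X]))
    (G.map (mapRingHom φ)) G.natDegree
    (by simp only [leadingCoeff_X_sub_C, Finset.prod_const_one]; exact one_ne_zero) hG
  rw [hdeg] at h
  rw [h]
  refine Finset.prod_congr rfl fun i _ => ?_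
  rw [natDegree_X_sub_C, resultant_X_sub_C_left _ _ _ hG, map_taylor, taylor_eval, map_map,
    mapRingHom_comp_C, taylor_apply, comp, coe_mapRingHom, eval₂_map,
    eval_map]
  simp [add_comm]

open Polynomial in
lemma prod_toFinset_nthRoots_one {B M : Type*} [CommRing B] [IsDomain B] [DecidableEq B]
    [CommMonoid M] {k : ℕ} {ζ : B} (hζ : IsPrimitiveRoot ζ k) (g : B → M) :
    ∏ w ∈ (nthRoots k (1 : B)).toFinset, g w = ∏ i ∈ Finset.range k, g (ζ ^ i) := by
  rw [Finset.prod_eq_multiset_prod, Multiset.toFinset_val, hζ.nthRoots_one_nodup.dedup,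
    hζ.nthRoots_eq (one_pow k), Multiset.map_map, Finset.prod_eq_multiset_prod]
  simp

lemma Fin.prod_piFinset_const_succ {α M : Type*} [CommMonoid M] (n : ℕ) (s : Finset α)
    (g : (Fin (n + 1) → α) → M) :
    ∏ w ∈ Fintype.piFinset (fun _ : Fin (n + 1) => s), g w =
      ∏ a ∈ s, ∏ w ∈ Fintype.piFinset (fun _ : Fin n => s), g (Fin.cons a w) := by
  rw [← Finset.prod_product']
  refine Finset.prod_nbij' (fun w => (w 0, Fin.tail w)) (fun p => Fin.cons p.1 p.2) ?_ ?_ ?_ ?_ ?_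
  · intro w hw
    simp_all [Fin.tail]
  · rintro ⟨a, w⟩ hw
    simp_all [Fin.forall_fin_succ]
  all_goals simp

open Polynomial in
lemma prod_X_add_C_sum_mem_lifts {A B : Type*} [CommRing A] [CommRing B] [IsDomain B]
    [Algebra ℂ B] (φ : A →+* B) {k : ℕ} (hk : 0 < k) (n : ℕ) (y : Fin n → B)
    (hy : ∀ i, y i ^ k ∈ φ.range) :
    ∏ w ∈ Fintype.piFinset (fun _ : Fin n => (nthRoots k (1 : ℂ)).toFinset),
      (X + C (∑ i, algebraMap ℂ B (w i) * y i)) ∈ lifts φ := by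
  induction n with
  | zero => simpa using X_mem_lifts φ
  | succ n ih =>
    have hζ := Complex.isPrimitiveRoot_exp k hk.ne'
    have h := prod_taylor_mem_lifts φ hk
      (hζ.map_of_injective (FaithfulSMul.algebraMap_injective ℂ B))
      (ih (fun i => y i.succ) fun i => hy i.succ) (hy 0)
    rw [Fin.prod_piFinset_const_succ, prod_toFinset_nthRoots_one hζ]
    convert h using 2 with i
    simp only [taylor_apply, prod_comp]
    refine Finset.prod_congr rfl fun w _ => ?_
    simp [Fin.sum_univ_succ, add_assoc]

open Polynomial in
/-- An identity `P * t ^ (k * m) = Q(t ^ k * x)` for all `t` isolates the homogeneous component of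
`Q` of degree `m`. -/
lemma aeval_homogeneousComponent_of_forall {σ : Type*} {k m : ℕ} (hk : 0 < k)
    (Q : MvPolynomial σ ℤ) (x : σ → ℂ) (P : ℂ)
    (h : ∀ t : ℂ, t ^ (k * m) * P = MvPolynomial.aeval (fun i => t ^ k * x i) Q) :
    P = MvPolynomial.aeval x (MvPolynomial.homogeneousComponent m Q) := by
  have hhom (t : ℂ) (j : ℕ) : MvPolynomial.aeval (fun i => t ^ k * x i)
      (MvPolynomial.homogeneousComponent j Q) =
      t ^ (k * j) * MvPolynomial.aeval x (MvPolynomial.homogeneousComponent j Q) := by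
    have hj := MvPolynomial.homogeneousComponent_isHomogeneous j Q
    rw [MvPolynomial.aeval_def, MvPolynomial.aeval_def, MvPolynomial.eval₂_eq,
      MvPolynomial.eval₂_eq, Finset.mul_sum]
    refine Finset.sum_congr rfl fun d hd => ?_
    have hdj : ∑ i ∈ d.support, d i = j := by
      have := hj (MvPolynomial.mem_support_iff.1 hd)
      rwa [Pi.one_def, ← Finsupp.degree_eq_weight_one] at this
    simp only [mul_pow, Finset.prod_mul_distrib, ← pow_mul, Finset.prod_pow_eq_pow_sum,
      ← Finset.mul_sum, hdj]
    ring
  have hpoly : (X ^ (k * m) * C P : ℂ[X]) = ∑ j ∈ Finset.range (Q.totalDegree + 1),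
      X ^ (k * j) * C (MvPolynomial.aeval x (MvPolynomial.homogeneousComponent j Q)) := by
    refine Polynomial.funext fun t => ?_
    have ht := h t
    rw [← MvPolynomial.sum_homogeneousComponent Q, map_sum] at ht
    simp only [hhom] at ht
    simpa only [eval_finsetSum, eval_mul, eval_pow, eval_X, eval_C] using ht
  have hc := congrArg (fun p => coeff p (k * m)) hpoly
  simp only [coeff_mul_C, finsetSum_coeff, coeff_X_pow, mul_right_inj' hk.ne', if_true, one_mul,
    ite_mul, zero_mul, Finset.sum_ite_eq, Finset.mem_range] at hc
  rw [hc]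
  split_ifs with hm
  · rfl
  · rw [MvPolynomial.homogeneousComponent_eq_zero _ _ (by omega), map_zero]

/-- For `k ≥ 1`, `d ≥ 1`, there is an integer polynomial `Q` in `d` variables,
homogeneous of degree `k^(d-1)`, such that for all complex `r₁,…,r_d`,
`∏_{(w₁,…,w_d) ∈ μ_k^d} (w₁r₁ + ⋯ + w_d r_d) = Q(r₁^k,…,r_d^k)`. -/
theorem product_over_roots_of_unity_is_polynomial_in_kth_powers
    (k d : ℕ) (hk : 1 ≤ k) (hd : 1 ≤ d) :
    ∃ Q : MvPolynomial (Fin d) ℤ,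
      Q.IsHomogeneous (k ^ (d - 1)) ∧
      ∀ r : Fin d → ℂ,
        ∏ w ∈ Fintype.piFinset (fun _ : Fin d => (Polynomial.nthRoots k (1 : ℂ)).toFinset),
          (∑ i, w i * r i)
          = MvPolynomial.aeval (fun i => (r i) ^ k) Q := by
  let φ : MvPolynomial (Fin d) ℤ →+* MvPolynomial (Fin d) ℂ :=
    (MvPolynomial.aeval fun i => MvPolynomial.X i ^ k).toRingHom
  obtain ⟨q, hq⟩ := (Polynomial.mem_lifts _).1 <| prod_X_add_C_sum_mem_lifts φ hk d MvPolynomial.X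
    fun i => ⟨MvPolynomial.X i, by simp [φ]⟩
  have key (r : Fin d → ℂ) :
      ∏ w ∈ Fintype.piFinset (fun _ : Fin d => (Polynomial.nthRoots k (1 : ℂ)).toFinset),
        (∑ i, w i * r i) = MvPolynomial.aeval (fun i => r i ^ k) (q.coeff 0) := by
    have h := congrArg (fun p => MvPolynomial.aeval r (p.coeff 0)) hq
    have hcomp : (MvPolynomial.aeval r).toRingHom.comp φ =
        (MvPolynomial.aeval (R := ℤ) fun i => r i ^ k).toRingHom := by
      ext <;> simp [φ]
    have h' := congrArg (fun f => f (q.coeff 0)) hcomp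
    rw [Polynomial.coeff_zero_eq_eval_zero (∏ _ ∈ _, _), Polynomial.eval_prod, map_prod,
      Polynomial.coeff_map] at h
    simp only [Polynomial.eval_add, Polynomial.eval_X, Polynomial.eval_C, zero_add] at h
    simp only [map_sum, map_mul, MvPolynomial.aeval_X, AlgHom.commutes, Algebra.algebraMap_self,
      RingHom.id_apply] at h
    exact h.symm.trans h'
  refine ⟨MvPolynomial.homogeneousComponent (k ^ (d - 1)) (q.coeff 0),
    MvPolynomial.homogeneousComponent_isHomogeneous _ _, fun r => ?_⟩
  refine aeval_homogeneousComponent_of_forall hk _ _ _ fun t => ?_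
  have hcard : (Polynomial.nthRoots k (1 : ℂ)).toFinset.card = k := by
    simpa using prod_toFinset_nthRoots_one (Complex.isPrimitiveRoot_exp k (by omega))
      (fun _ => Multiplicative.ofAdd (1 : ℕ))
  have hkd : k * k ^ (d - 1) = k ^ d := by rw [← pow_succ', Nat.sub_add_cancel hd]
  simp only [← mul_pow]
  rw [← key fun i => t * r i]
  simp only [mul_left_comm _ t, ← Finset.mul_sum, Finset.prod_mul_distrib, Finset.prod_const,
    Fintype.card_piFinset_const, hcard, hkd]
end

section
/- Let k ≥ 1 and n ≥ 2 be integers. Regard x ↦ f_k(x,n) as a real polynomial function and write f_k^{(r)}(x,n) for its r-th derivative at x (so f_k^{(r)}(·,n) = 0 whenever r > n−2, since f_k(·,n) is a polynomial of degree n−2). Then for all real numbers a_1 and a_2: f_k(a_2, n+1) = (a_1+a_2+k)·f_k(a_1+a_2, n) + ∑_{r=1}^{n−1} (−(a_1+k))^r · [ f_k^{(r−1)}(a_1+a_2, n)/(r−1)! + (a_1+a_2+k)·f_k^{(r)}(a_1+a_2, n)/r! ]. -/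
/-- The `(k,m)`-partial product of `a`: `f_k(a,1) = 1/(a+k)`, `f_k(a,2) = 1`,
and `f_k(a,m) = ∏_{j=0}^{m-3} (a - k·j)` for `m ≥ 3`. -/
noncomputable def fk (k : ℕ) (a : ℝ) (m : ℕ) : ℝ :=
  if m = 1 then 1 / (a + k) else ∏ j ∈ Finset.range (m - 2), (a - k * j)

namespace Polynomial

theorem iteratedDeriv_eval {𝕜 : Type*} [NontriviallyNormedField 𝕜] (p : 𝕜[X]) (r : ℕ) :
    iteratedDeriv r (fun x => p.eval x) = fun x => (derivative^[r] p).eval x := by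
  induction r with
  | zero => simp
  | succ r ih =>
    rw [iteratedDeriv_succ, ih, Function.iterate_succ_apply']
    ext x
    exact Polynomial.deriv _

theorem taylor_coeff_eq_iteratedDeriv {𝕜 : Type*} [NontriviallyNormedField 𝕜] [CharZero 𝕜]
    (p : 𝕜[X]) (r : ℕ) (x : 𝕜) :
    (taylor x p).coeff r = iteratedDeriv r (fun y => p.eval y) x / r.factorial := by
  rw [iteratedDeriv_eval, taylor_coeff, eq_div_iff (by exact_mod_cast r.factorial_ne_zero),
    ← factorial_smul_hasseDeriv]
  simp [mul_comm]

theorem eval_add_eq_sum_iteratedDeriv {𝕜 : Type*} [NontriviallyNormedField 𝕜] [CharZero 𝕜]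
    (p : 𝕜[X]) {m : ℕ} (hm : p.natDegree < m) (x h : 𝕜) :
    p.eval (x + h) =
      ∑ r ∈ Finset.range m, h ^ r * (iteratedDeriv r (fun y => p.eval y) x / r.factorial) := by
  rw [add_comm, ← taylor_eval, eval_eq_sum_range' (by rwa [natDegree_taylor])]
  simp_rw [taylor_coeff_eq_iteratedDeriv, mul_comm]

end Polynomial

theorem fk_succ (k n : ℕ) (hn : 2 ≤ n) (a : ℝ) : fk k a (n + 1) = a * fk k (a - k) n := by
  obtain ⟨m, rfl⟩ := Nat.exists_eq_add_of_le' hn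
  simp only [fk, show m + 2 + 1 ≠ 1 by omega, show m + 2 ≠ 1 by omega, if_false,
    show m + 2 + 1 - 2 = m + 1 by omega, Nat.add_sub_cancel, Finset.prod_range_succ']
  rw [mul_comm]
  congr 1
  · simp
  · refine Finset.prod_congr rfl fun j _ => ?_
    push_cast
    ring

open Polynomial in
theorem exists_polynomial_fk (k n : ℕ) (hn : 2 ≤ n) :
    ∃ p : ℝ[X], p.natDegree = n - 2 ∧ ∀ x, fk k x n = p.eval x := by
  refine ⟨∏ j ∈ Finset.range (n - 2), (X - C ((k : ℝ) * j)), ?_, fun x => ?_⟩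
  · rw [natDegree_prod_of_monic _ _ fun j _ => monic_X_sub_C _]
    simp only [natDegree_X_sub_C, Finset.sum_const, Finset.card_range, smul_eq_mul, mul_one]
  · simp [fk, show n ≠ 1 by omega, eval_prod]

/-- the splitting identity for `f_k`, where `f_k^{(r)}(·,n)` is the `r`-th
derivative of the polynomial function `x ↦ f_k(x,n)`. -/
theorem fk_split (k n : ℕ) (hk : 1 ≤ k) (hn : 2 ≤ n) (a1 a2 : ℝ) :
    fk k a2 (n + 1) =
      (a1 + a2 + k) * fk k (a1 + a2) n +
      ∑ r ∈ Finset.Icc 1 (n - 1),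
        (-(a1 + k)) ^ r *
          (iteratedDeriv (r - 1) (fun x => fk k x n) (a1 + a2) / (Nat.factorial (r - 1)) +
            (a1 + a2 + k) * iteratedDeriv r (fun x => fk k x n) (a1 + a2) / (Nat.factorial r)) := by
  obtain ⟨p, hp, hf⟩ := exists_polynomial_fk k n hn
  rw [fk_succ k n hn]
  simp only [hf]
  have h₁ := p.eval_add_eq_sum_iteratedDeriv (m := n - 1) (by omega) (a1 + a2) (-(a1 + k))
  have h₂ := p.eval_add_eq_sum_iteratedDeriv (m := n - 1 + 1) (by omega) (a1 + a2) (-(a1 + k))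
  rw [Finset.sum_range_succ'] at h₂
  rw [show a1 + a2 + -(a1 + k) = a2 - k by ring] at h₁ h₂
  rw [← Finset.Ico_add_one_right_eq_Icc, Finset.sum_Ico_eq_sum_range, Nat.add_sub_cancel]
  calc a2 * p.eval (a2 - k)
      = -(a1 + k) * p.eval (a2 - k) + (a1 + a2 + k) * p.eval (a2 - k) := by ring
    _ = _ := by
      nth_rw 1 [h₁]
      rw [h₂, mul_add, Finset.mul_sum, Finset.mul_sum, ← add_assoc, ← Finset.sum_add_distrib,
        add_comm]
      congr 1
      · simp
      · refine Finset.sum_congr rfl fun r _ => ?_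
        rw [add_comm 1 r, Nat.add_sub_cancel]
        ring
end

section
/- Let k ≥ 1 and p ≥ 1 be integers, and let a_1, a_2 be integers with a_1 > −k, a_2 > −k, k ∤ a_1, k ∤ a_2, and a_1 + a_2 = (p−2)·k. Set ℓ_1 = ⌈a_1/k⌉. Then ∑_{I ⊆ {1,…,p}, a_1 − |I|·k + k > 0} (a_1 − |I|·k + k) · f_k(a_1, |I|+1) · f_k(a_2, p+1−|I|) = binom(p−1, ℓ_1) · a_1!_{(k)} · a_2!_{(k)}, where the sum runs over all subsets I of {1,…,p} with a_1 − |I|·k + k > 0. Equivalently, ∑_{i=0}^{ℓ_1} binom(p,i) · f_k(a_1, i+2) · f_k(a_2, p+1−i) = binom(p−1, ℓ_1) · a_1!_{(k)} · a_2!_{(k)}. -/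
/-- The `k`-factorial `a!_{(k)} = ∏_{i=0}^{⌈a/k⌉-1} (a - i·k)` (empty product being `1`). -/
noncomputable def kfac (k : ℕ) (a : ℤ) : ℝ :=
  ∏ i ∈ Finset.range (⌈(a : ℚ) / (k : ℚ)⌉.toNat), ((a : ℝ) - k * i)

theorem fk_add_two (k : ℕ) (a : ℝ) (n : ℕ) :
    fk k a (n + 2) = ∏ j ∈ Finset.range n, (a - k * j) := by
  simp [fk]

/-- The factor `a - nk + k` turns `f_k(a, n+1)` into `f_k(a, n+2)`. -/
theorem mul_fk_succ (k : ℕ) (a : ℝ) (ha : a + k ≠ 0) (n : ℕ) :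
    (a - n * k + k) * fk k a (n + 1) = fk k a (n + 2) := by
  cases n with
  | zero => simp [fk, ha]
  | succ n =>
    rw [fk_add_two, fk_add_two, Finset.prod_range_succ]
    push_cast
    ring

/-- The partial sums of the degree formula telescope. -/
theorem sum_choose_mul_fk_mul_fk (k p : ℕ) (a b : ℝ) (hab : a + b = ((p : ℝ) - 2) * k) (n : ℕ)
    (hn : n + 1 ≤ p) :
    ∑ i ∈ Finset.range (n + 1), (Nat.choose p i : ℝ) * fk k a (i + 2) * fk k b (p + 1 - i)
      = (Nat.choose (p - 1) n : ℝ) * fk k a (n + 2) * fk k b (p + 1 - n) := by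
  induction n with
  | zero => simp
  | succ n ih =>
    obtain ⟨m, rfl⟩ := Nat.exists_eq_add_of_le hn
    rw [Finset.sum_range_succ, ih (by omega),
      show n + 1 + 1 + m + 1 - n = m + 1 + 2 by omega,
      show n + 1 + 1 + m + 1 - (n + 1) = m + 2 by omega,
      show n + 1 + 1 + m - 1 = n + m + 1 by omega,
      show n + 1 + 1 + m = n + m + 1 + 1 by omega,
      Nat.choose_succ_succ (n + m + 1) n]
    simp only [fk_add_two, Finset.prod_range_succ]
    have hb : b - k * m = -(a - k * n) := by
      push_cast at hab
      linear_combination hab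
    rw [hb]
    push_cast
    ring

theorem ceil_div_toNat_strict_bounds {k : ℕ} {a : ℤ} (hk : 1 ≤ k) (ha : -(k : ℤ) < a)
    (hd : ¬ (k : ℤ) ∣ a) :
    (((⌈(a : ℚ) / (k : ℚ)⌉.toNat : ℕ) : ℤ) - 1) * k < a ∧
      a < ((⌈(a : ℚ) / (k : ℚ)⌉.toNat : ℕ) : ℤ) * k := by
  have hk' : (0 : ℚ) < k := by exact_mod_cast hk
  have h0 : 0 ≤ ⌈(a : ℚ) / (k : ℚ)⌉ := by
    have : (-1 : ℤ) < ⌈(a : ℚ) / (k : ℚ)⌉ := by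
      rw [Int.lt_ceil, lt_div_iff₀ hk']
      have : (-(k : ℚ)) < a := by exact_mod_cast ha
      push_cast
      linarith
    omega
  rw [Int.toNat_of_nonneg h0]
  generalize hc : ⌈(a : ℚ) / (k : ℚ)⌉ = c
  rw [Int.ceil_eq_iff, lt_div_iff₀ hk', div_le_iff₀ hk'] at hc
  refine ⟨by exact_mod_cast hc.1, lt_of_le_of_ne (by exact_mod_cast hc.2) ?_⟩
  rintro rfl
  exact hd (dvd_mul_left _ _)

/-- the degree of the isoresidual cover of `Ω^k M₀(a₁,a₂,-k,…,-k)` (`p` poles):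
`∑_{I ⊆ {1,…,p}, a₁ - |I|k + k > 0} (a₁ - |I|k + k) f_k(a₁,|I|+1) f_k(a₂,p+1-|I|)
  = C(p-1, ⌈a₁/k⌉) ⋅ a₁!_{(k)} ⋅ a₂!_{(k)}`, and equivalently
`∑_{i=0}^{⌈a₁/k⌉} C(p,i) f_k(a₁,i+2) f_k(a₂,p+1-i) = C(p-1, ⌈a₁/k⌉) ⋅ a₁!_{(k)} ⋅ a₂!_{(k)}`. -/
theorem degree_isoresidual_cover_poles_order_k (k p : ℕ) (hk : 1 ≤ k) (hp : 1 ≤ p)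
    (a1 a2 : ℤ) (h1 : -(k : ℤ) < a1) (h2 : -(k : ℤ) < a2)
    (hd1 : ¬ (k : ℤ) ∣ a1) (hd2 : ¬ (k : ℤ) ∣ a2)
    (hsum : a1 + a2 = ((p : ℤ) - 2) * k) :
    (∑ I ∈ (Finset.univ : Finset (Fin p)).powerset.filter
        (fun I => 0 < a1 - (I.card : ℤ) * k + k),
      ((a1 - (I.card : ℤ) * k + k : ℤ) : ℝ) * fk k (a1 : ℝ) (I.card + 1) *
        fk k (a2 : ℝ) (p + 1 - I.card)
      = (Nat.choose (p - 1) (⌈(a1 : ℚ) / (k : ℚ)⌉.toNat) : ℝ) * kfac k a1 * kfac k a2)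
    ∧
    (∑ i ∈ Finset.range (⌈(a1 : ℚ) / (k : ℚ)⌉.toNat + 1),
      (Nat.choose p i : ℝ) * fk k (a1 : ℝ) (i + 2) * fk k (a2 : ℝ) (p + 1 - i)
      = (Nat.choose (p - 1) (⌈(a1 : ℚ) / (k : ℚ)⌉.toNat) : ℝ) * kfac k a1 * kfac k a2) := by
  have hk0 : (0 : ℤ) < k := by exact_mod_cast hk
  obtain ⟨l1, u1⟩ := ceil_div_toNat_strict_bounds hk h1 hd1
  obtain ⟨l2, u2⟩ := ceil_div_toNat_strict_bounds hk h2 hd2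
  unfold kfac
  generalize ⌈(a1 : ℚ) / (k : ℚ)⌉.toNat = m at *
  generalize ⌈(a2 : ℚ) / (k : ℚ)⌉.toNat = n at *
  have hp' : p = m + n + 1 := by
    have hlt : ((m : ℤ) + n) < p := lt_of_mul_lt_mul_right (by linarith) hk0.le
    have hgt : (p : ℤ) < m + n + 2 := lt_of_mul_lt_mul_right (by linarith) hk0.le
    omega
  have hsecond : ∑ i ∈ Finset.range (m + 1),
      (Nat.choose p i : ℝ) * fk k (a1 : ℝ) (i + 2) * fk k (a2 : ℝ) (p + 1 - i)
      = (Nat.choose (p - 1) m : ℝ) * (∏ i ∈ Finset.range m, ((a1 : ℝ) - k * i)) *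
        ∏ i ∈ Finset.range n, ((a2 : ℝ) - k * i) := by
    rw [sum_choose_mul_fk_mul_fk k p a1 a2 (by exact_mod_cast hsum) m (by omega),
      show p + 1 - m = n + 2 by omega, fk_add_two, fk_add_two]
  refine ⟨?_, hsecond⟩
  have hne : (a1 : ℝ) + k ≠ 0 := by
    have : (0 : ℤ) < a1 + k := by linarith
    exact_mod_cast this.ne'
  have hiff (i : ℕ) : 0 < a1 - (i : ℤ) * k + k ↔ i < m + 1 := by
    constructor
    · intro h
      have : (i : ℤ) < m + 1 := lt_of_mul_lt_mul_right (by linarith) hk0.le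
      omega
    · intro h
      have : (i : ℤ) * k ≤ m * k := mul_le_mul_of_nonneg_right (by omega) hk0.le
      linarith
  rw [← hsecond, Finset.sum_filter, Finset.sum_powerset_apply_card
    (fun i : ℕ => if 0 < a1 - (i : ℤ) * k + k then
      ((a1 - (i : ℤ) * k + k : ℤ) : ℝ) * fk k (a1 : ℝ) (i + 1) * fk k (a2 : ℝ) (p + 1 - i)
      else 0)]
  simp only [Finset.card_univ, Fintype.card_fin, hiff]
  symm
  refine Finset.sum_subset_zero_on_sdiff (Finset.range_subset_range.2 (by omega)) ?_ ?_
  · intro i hi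
    simp only [Finset.mem_sdiff, Finset.mem_range] at hi
    simp [hi.2]
  · intro i hi
    rw [if_pos (Finset.mem_range.1 hi), ← mul_fk_succ k a1 hne i, nsmul_eq_mul]
    push_cast
    ring
end

section
/- Let k ≥ 1 and p ≥ 1 be integers, let a_1, a_2 be integers with a_1 > −k, a_2 > −k, k ∤ a_1, k ∤ a_2, and let b_1, …, b_p be positive integers, each divisible by k, satisfying a_1 + a_2 − (b_1 + ⋯ + b_p) = −2k. For a subset I ⊆ {1,…,p} and j ∈ {1,2}, set c_{j,I} = a_j − ∑_{i∈I} b_i + k. Then ∑_{I ⊆ {1,…,p}, c_{1,I} > 0} c_{1,I} · f_k(a_1, |I|+1) · f_k(a_2, p+1−|I|) = ∑_{I ⊆ {1,…,p}, c_{2,I} > 0} c_{2,I} · f_k(a_2, |I|+1) · f_k(a_1, p+1−|I|). -/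
/-- The falling factorial `x (x - k) ⋯ (x - (m - 1) k)` with step `k`. -/
noncomputable def stepFactorial (k x : ℝ) (m : ℕ) : ℝ :=
  ∏ j ∈ Finset.range m, (x - k * j)

theorem stepFactorial_succ (k x : ℝ) (m : ℕ) :
    stepFactorial k x (m + 1) = stepFactorial k x m * (x - k * m) :=
  Finset.prod_range_succ _ _

theorem stepFactorial_succ' (k x : ℝ) (m : ℕ) :
    stepFactorial k x (m + 1) = x * stepFactorial k (x - k) m := by
  rw [stepFactorial, Finset.prod_range_succ', mul_comm, stepFactorial]
  congr 1
  · simp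
  · refine Finset.prod_congr rfl fun j _ => ?_
    push_cast
    ring

theorem fk_succ_s4 (k : ℕ) (a : ℝ) (ha : a + k ≠ 0) (m : ℕ) :
    fk k a (m + 1) = stepFactorial k (a + k) m / (a + k) := by
  rw [eq_div_iff ha]
  cases m with
  | zero => simp [fk, stepFactorial, ha]
  | succ m =>
    rw [stepFactorial_succ', add_sub_cancel_right, mul_comm]
    simp [fk, stepFactorial]

/-- The Chu–Vandermonde identity, as a sum over subsets. -/
theorem sum_powerset_stepFactorial {ι : Type*} [DecidableEq ι] (k x y : ℝ) (S : Finset ι) :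
    ∑ I ∈ S.powerset, stepFactorial k x I.card * stepFactorial k y (S.card - I.card)
      = stepFactorial k (x + y) S.card := by
  induction S using Finset.induction_on with
  | empty => simp [stepFactorial]
  | insert a S ha ih =>
    rw [Finset.sum_powerset_insert ha, ← Finset.sum_add_distrib,
      Finset.card_insert_of_notMem ha, stepFactorial_succ, ← ih, Finset.sum_mul]
    refine Finset.sum_congr rfl fun I hI => ?_
    have hIS := Finset.mem_powerset.mp hI
    obtain ⟨d, hd⟩ := Nat.exists_eq_add_of_le (Finset.card_le_card hIS)
    rw [Finset.card_insert_of_notMem fun h => ha (hIS h), hd,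
      show I.card + d + 1 - I.card = d + 1 by lia,
      show I.card + d + 1 - (I.card + 1) = d by lia,
      show I.card + d - I.card = d by lia, stepFactorial_succ, stepFactorial_succ]
    push_cast
    ring

/-- The part of the Chu–Vandermonde sum running over the subsets that contain a given element. -/
theorem sum_powerset_stepFactorial_mem {ι : Type*} [DecidableEq ι] (k x y : ℝ) (S : Finset ι)
    {i : ι} (hi : i ∈ S) :
    ∑ I ∈ S.powerset,
        (if i ∈ I then stepFactorial k x I.card * stepFactorial k y (S.card - I.card) else 0)
      = x * stepFactorial k (x + y - k) (S.card - 1) := by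
  obtain ⟨T, hT, rfl⟩ : ∃ T, i ∉ T ∧ insert i T = S :=
    ⟨S.erase i, Finset.notMem_erase i S, Finset.insert_erase hi⟩
  rw [Finset.sum_powerset_insert hT, Finset.card_insert_of_notMem hT, Nat.add_sub_cancel,
    show x + y - k = x - k + y by ring, ← sum_powerset_stepFactorial, Finset.mul_sum,
    Finset.sum_eq_zero, zero_add]
  · refine Finset.sum_congr rfl fun I hI => ?_
    rw [if_pos (Finset.mem_insert_self i I),
      Finset.card_insert_of_notMem fun h => hT (Finset.mem_powerset.mp hI h),
      stepFactorial_succ', Nat.add_sub_add_right]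
    ring
  · exact fun I hI => if_neg fun h => hT (Finset.mem_powerset.mp hI h)

theorem sum_powerset_sub_sum_mul_stepFactorial {ι : Type*} [DecidableEq ι] (k x y : ℝ)
    (S : Finset ι) (hS : S.Nonempty) (b : ι → ℝ) (hb : ∑ i ∈ S, b i = x + y) :
    ∑ I ∈ S.powerset, (x - ∑ i ∈ I, b i) *
      (stepFactorial k x I.card * stepFactorial k y (S.card - I.card)) = 0 := by
  have key : ∑ I ∈ S.powerset, (∑ i ∈ I, b i) *
      (stepFactorial k x I.card * stepFactorial k y (S.card - I.card))
      = (x + y) * (x * stepFactorial k (x + y - k) (S.card - 1)) := by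
    rw [← hb, Finset.sum_mul, hb]
    calc _ = ∑ I ∈ S.powerset, ∑ i ∈ S, b i * (if i ∈ I then
            stepFactorial k x I.card * stepFactorial k y (S.card - I.card) else 0) := by
          refine Finset.sum_congr rfl fun I hI => ?_
          simp only [mul_ite, mul_zero]
          rw [← Finset.sum_filter, Finset.filter_mem_eq_inter,
            Finset.inter_eq_right.mpr (Finset.mem_powerset.mp hI), Finset.sum_mul]
      _ = _ := by
          rw [Finset.sum_comm]
          refine Finset.sum_congr rfl fun i hi => ?_
          rw [← Finset.mul_sum, sum_powerset_stepFactorial_mem k x y S hi]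
  simp only [sub_mul]
  rw [Finset.sum_sub_distrib, key, ← Finset.mul_sum, sum_powerset_stepFactorial]
  obtain ⟨n, hn⟩ := Nat.exists_eq_succ_of_ne_zero hS.card_pos.ne'
  rw [hn, Nat.succ_eq_add_one, stepFactorial_succ', Nat.add_sub_cancel]
  ring

/-- the two expansions of the degree `d_k(μ)` of the isoresidual cover agree:
expanding with respect to the zero of order `a₁` or to the zero of order `a₂` gives the
same value. Here `c_{j,I} = a_j - ∑_{i∈I} b_i + k`. -/
theorem degree_isoresidual_symmetry (k p : ℕ) (hk : 1 ≤ k) (hp : 1 ≤ p)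
    (a1 a2 : ℤ) (b : Fin p → ℤ)
    (h1 : -(k : ℤ) < a1) (h2 : -(k : ℤ) < a2)
    (hd1 : ¬ (k : ℤ) ∣ a1) (hd2 : ¬ (k : ℤ) ∣ a2)
    (hb : ∀ i, 0 < b i ∧ (k : ℤ) ∣ b i)
    (hsum : a1 + a2 - (∑ i, b i) = -2 * (k : ℤ)) :
    ∑ I ∈ (Finset.univ : Finset (Fin p)).powerset.filter
        (fun I => 0 < a1 - (∑ i ∈ I, b i) + k),
      ((a1 - (∑ i ∈ I, b i) + k : ℤ) : ℝ) * fk k (a1 : ℝ) (I.card + 1) *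
        fk k (a2 : ℝ) (p + 1 - I.card)
    = ∑ I ∈ (Finset.univ : Finset (Fin p)).powerset.filter
        (fun I => 0 < a2 - (∑ i ∈ I, b i) + k),
      ((a2 - (∑ i ∈ I, b i) + k : ℤ) : ℝ) * fk k (a2 : ℝ) (I.card + 1) *
        fk k (a1 : ℝ) (p + 1 - I.card) := by
  have hx : (a1 : ℝ) + k ≠ 0 := by
    have : a1 + (k : ℤ) ≠ 0 := by lia
    exact_mod_cast this
  have hy : (a2 : ℝ) + k ≠ 0 := by
    have : a2 + (k : ℤ) ≠ 0 := by lia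
    exact_mod_cast this
  set t : Finset (Fin p) → ℝ := fun I => ((a1 - (∑ i ∈ I, b i) + k : ℤ) : ℝ) *
    fk k (a1 : ℝ) (I.card + 1) * fk k (a2 : ℝ) (p + 1 - I.card) with ht
  have hcard (I : Finset (Fin p)) : I.card ≤ p := by simpa using I.card_le_univ
  have total : ∑ I : Finset (Fin p), t I = 0 := by
    have hbsum : ∑ i, (b i : ℝ) = (a1 + k) + (a2 + k) := by
      have : ∑ i, b i = (a1 + k) + (a2 + k) := by linarith
      exact_mod_cast this
    have hne : (Finset.univ : Finset (Fin p)).Nonempty := ⟨⟨0, hp⟩, Finset.mem_univ _⟩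
    have h := sum_powerset_sub_sum_mul_stepFactorial (k : ℝ) _ _ _ hne _ hbsum
    rw [Finset.powerset_univ, Finset.card_univ, Fintype.card_fin] at h
    rw [← zero_div (((a1 : ℝ) + k) * (a2 + k)), ← h, Finset.sum_div]
    refine Finset.sum_congr rfl fun I _ => ?_
    simp only [ht]
    rw [Nat.sub_add_comm (hcard I), fk_succ_s4 k _ hx, fk_succ_s4 k _ hy]
    push_cast
    field_simp
    ring
  have compl : ∑ I ∈ (Finset.univ : Finset (Fin p)).powerset.filter
        (fun I => 0 < a2 - (∑ i ∈ I, b i) + k),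
      ((a2 - (∑ i ∈ I, b i) + k : ℤ) : ℝ) * fk k (a2 : ℝ) (I.card + 1) *
        fk k (a1 : ℝ) (p + 1 - I.card)
      = ∑ I : Finset (Fin p), if a1 - (∑ i ∈ I, b i) + k < 0 then -t I else 0 := by
    rw [Finset.powerset_univ, Finset.sum_filter]
    refine Fintype.sum_equiv compl_involutive.toPerm _ _ fun I => ?_
    have hc : a1 - (∑ i ∈ Iᶜ, b i) + k = -(a2 - (∑ i ∈ I, b i) + k) := by
      linarith [Finset.sum_add_sum_compl I b]
    simp only [Function.Involutive.coe_toPerm, ht, hc, neg_lt_zero, 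
      Finset.card_compl, Fintype.card_fin]
    have := hcard I
    rw [show p + 1 - (p - I.card) = I.card + 1 by lia,
      show p - I.card + 1 = p + 1 - I.card by lia]
    refine if_congr Iff.rfl ?_ rfl
    push_cast
    ring
  rw [compl, Finset.powerset_univ, Finset.sum_filter, ← sub_eq_zero, ← Finset.sum_sub_distrib]
  refine Eq.trans (Finset.sum_congr rfl fun I _ => ?_) total
  change (if 0 < a1 - (∑ i ∈ I, b i) + k then t I else 0) - _ = _
  rcases lt_trichotomy (a1 - (∑ i ∈ I, b i) + k) 0 with h | h | h
  · simp [h, h.not_gt]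
  · simp only [ht, h]
    simp
  · simp [h, h.not_gt]
end

section
/- Let k ≥ 1, c ≥ 0, and f be integers with 0 < f < k, and set a = c·k + f. Then a!_{(k)} = k^{c+1} · Γ(a/k + 1) / Γ(f/k), where Γ denotes the real Gamma function. (Here ⌈a/k⌉ = c + 1, so a!_{(k)} = a·(a−k)·(a−2k)⋯(a−ck).) -/
theorem Real.Gamma_add_nat_eq_prod {x : ℝ} (hx : 0 < x) (n : ℕ) :
    Real.Gamma (x + n) = (∏ i ∈ Finset.range n, (x + i)) * Real.Gamma x := by
  induction n with
  | zero => simp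
  | succ n ih =>
    rw [Finset.prod_range_succ, Nat.cast_succ, ← add_assoc, Real.Gamma_add_one (by positivity), ih]
    ring

/-- for `a = c·k + f` with `0 < f < k`,
`a!_{(k)} = k^{c+1} · Γ(a/k + 1) / Γ(f/k)`. -/
theorem kfac_eq_gamma (k c f : ℕ) (hk : 1 ≤ k) (hf : 0 < f) (hfk : f < k) :
    kfac k ((c : ℤ) * k + f) =
      (k : ℝ) ^ (c + 1) * Real.Gamma (((c : ℝ) * k + f) / k + 1) /
        Real.Gamma ((f : ℝ) / k) := by
  have hk0 : (0 : ℝ) < k := by exact_mod_cast hk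
  have hf0 : (0 : ℝ) < f := by exact_mod_cast hf
  have hx : (0 : ℝ) < (f : ℝ) / k := by positivity
  have hceil : ⌈(((c : ℤ) * k + f : ℤ) : ℚ) / (k : ℚ)⌉ = (c : ℤ) + 1 := by
    have hkq : (0 : ℚ) < k := by exact_mod_cast hk
    have hfq : (0 : ℚ) < f := by exact_mod_cast hf
    have hfkq : (f : ℚ) < k := by exact_mod_cast hfk
    rw [Int.ceil_eq_iff, lt_div_iff₀ hkq, div_le_iff₀ hkq]
    push_cast
    constructor <;> linarith
  have harg : ((c : ℝ) * k + f) / k + 1 = (f : ℝ) / k + (c + 1 : ℕ) := by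
    push_cast
    field_simp
    ring
  have hrange : ((c : ℤ) + 1).toNat = c + 1 := by omega
  have hpow : (k : ℝ) ^ (c + 1) = ∏ _i ∈ Finset.range (c + 1), (k : ℝ) := by simp
  rw [harg, Real.Gamma_add_nat_eq_prod hx, ← mul_assoc,
    mul_div_cancel_right₀ _ (Real.Gamma_pos_of_pos hx).ne', kfac, hceil, hrange,
    ← Finset.prod_range_reflect]
  rw [hpow, ← Finset.prod_mul_distrib]
  refine Finset.prod_congr rfl fun i hi => ?_
  have hic : i ≤ c := Nat.lt_succ_iff.mp (Finset.mem_range.mp hi)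
  rw [Nat.add_sub_cancel, Nat.cast_sub hic]
  push_cast
  field_simp
  ring
end

section
/- Let k ≥ 1 and p ≥ 3 be integers, and let a_1 = c_1·k + f_1 and a_2 = c_2·k + f_2 where c_1, c_2 ≥ 0 are integers, f_1, f_2 are integers with 0 < f_1 < k and 0 < f_2 < k, f_1 + f_2 = k, and c_1 + c_2 = p − 3 (equivalently a_1 + a_2 = (p−2)·k). Set α_i = (a_i + k)/k for i = 1,2. Then a_1!_{(k)} · a_2!_{(k)} = k^{p−1} · (sin(π·f_1/k)/π) · Γ(α_1) · Γ(α_2), where Γ is the real Gamma function; moreover sin(π·f_1/k) = |sin(π·α_1)|. -/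
theorem kfac_mul_add {k f : ℕ} (hf : 0 < f) (hfk : f < k) (c : ℕ) :
    kfac k ((c : ℤ) * k + f) =
      ∏ i ∈ Finset.range (c + 1), ((c : ℝ) * k + f - k * i) := by
  have hk : (0 : ℚ) < k := by exact_mod_cast hf.trans hfk
  have hf' : (0 : ℚ) < f := by exact_mod_cast hf
  have hfk' : (f : ℚ) < k := by exact_mod_cast hfk
  have hceil : ⌈(((c : ℤ) * k + f : ℤ) : ℚ) / (k : ℚ)⌉ = ((c + 1 : ℕ) : ℤ) := by
    rw [Int.ceil_eq_iff, lt_div_iff₀ hk, div_le_iff₀ hk]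
    push_cast
    constructor <;> nlinarith
  rw [kfac, hceil, Int.toNat_natCast]
  push_cast
  rfl

theorem kfac_mul_add_succ {k f : ℕ} (hf : 0 < f) (hfk : f < k) (c : ℕ) :
    kfac k (((c + 1 : ℕ) : ℤ) * k + f) =
      (((c : ℝ) + 1) * k + f) * kfac k ((c : ℤ) * k + f) := by
  rw [kfac_mul_add hf hfk, kfac_mul_add hf hfk, Finset.prod_range_succ', mul_comm]
  congr 1
  · push_cast
    ring
  · refine Finset.prod_congr rfl fun i _ => ?_
    push_cast
    ring

theorem kfac_mul_Gamma {k f : ℕ} (hf : 0 < f) (hfk : f < k) (c : ℕ) :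
    kfac k ((c : ℤ) * k + f) * Real.Gamma (f / k) =
      (k : ℝ) ^ (c + 1) * Real.Gamma ((((c : ℝ) * k + f) + k) / k) := by
  have hk : (0 : ℝ) < k := by exact_mod_cast hf.trans hfk
  have hf' : (0 : ℝ) < f := by exact_mod_cast hf
  induction c with
  | zero =>
    have hadd : (((0 : ℕ) : ℝ) * k + f + k) / k = f / k + 1 := by
      push_cast
      field_simp
      ring
    rw [kfac_mul_add hf hfk, hadd, Real.Gamma_add_one (div_pos hf' hk).ne']
    simp
    field_simp
  | succ c ih =>
    have hadd : (((c + 1 : ℕ) : ℝ) * k + f + k) / k = ((c : ℝ) * k + f + k) / k + 1 := by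
      push_cast
      field_simp
      ring
    rw [kfac_mul_add_succ hf hfk, mul_assoc, ih, hadd,
      Real.Gamma_add_one (by positivity)]
    field_simp
    ring

/-- for `a₁ = c₁k + f₁`, `a₂ = c₂k + f₂` with `0 < f₁, f₂ < k`, `f₁ + f₂ = k`,
`c₁ + c₂ = p - 3` (`p ≥ 3`), and `αᵢ = (aᵢ + k)/k`, one has
`a₁!_{(k)} · a₂!_{(k)} = k^{p-1} · (sin(π f₁/k)/π) · Γ(α₁) · Γ(α₂)`,
and moreover `sin(π f₁/k) = |sin(π α₁)|`. -/
theorem kfac_product_gamma (k p c1 c2 f1 f2 : ℕ) (hk : 1 ≤ k) (hp : 3 ≤ p)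
    (hf1 : 0 < f1) (hf1k : f1 < k) (hf2 : 0 < f2) (hf2k : f2 < k)
    (hff : f1 + f2 = k) (hcc : c1 + c2 = p - 3) :
    kfac k ((c1 : ℤ) * k + f1) * kfac k ((c2 : ℤ) * k + f2)
      = (k : ℝ) ^ (p - 1) * (Real.sin (Real.pi * f1 / k) / Real.pi) *
          Real.Gamma ((((c1 : ℝ) * k + f1) + k) / k) *
          Real.Gamma ((((c2 : ℝ) * k + f2) + k) / k)
    ∧ Real.sin (Real.pi * f1 / k)
      = |Real.sin (Real.pi * ((((c1 : ℝ) * k + f1) + k) / k))| := by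
  have hk0 : (0 : ℝ) < k := by exact_mod_cast hk
  have hf1' : (0 : ℝ) < f1 := by exact_mod_cast hf1
  have hf1k' : (f1 : ℝ) < k := by exact_mod_cast hf1k
  have hsin : 0 < Real.sin (Real.pi * f1 / k) := by
    apply Real.sin_pos_of_pos_of_lt_pi
    · positivity
    · rw [div_lt_iff₀ hk0]
      exact mul_lt_mul_of_pos_left hf1k' Real.pi_pos
  constructor
  · have hrefl := Real.Gamma_mul_Gamma_one_sub ((f1 : ℝ) / k)
    have hsub : 1 - (f1 : ℝ) / k = f2 / k := by
      rw [← hff]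
      push_cast
      field_simp
      ring
    rw [hsub, ← mul_div_assoc, eq_div_iff hsin.ne'] at hrefl
    have hp1 : p - 1 = (c1 + 1) + (c2 + 1) := by omega
    have h1 := kfac_mul_Gamma hf1 hf1k c1
    have h2 := kfac_mul_Gamma hf2 hf2k c2
    rw [hp1, pow_add, mul_div_assoc', div_mul_eq_mul_div, div_mul_eq_mul_div,
      eq_div_iff Real.pi_ne_zero]
    linear_combination
      Real.sin (Real.pi * f1 / k) * kfac k ((c2 : ℤ) * k + f2) * Real.Gamma (f2 / k) * h1 +
      Real.sin (Real.pi * f1 / k) * (k : ℝ) ^ (c1 + 1) *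
        Real.Gamma ((((c1 : ℝ) * k + f1) + k) / k) * h2 -
      kfac k ((c1 : ℤ) * k + f1) * kfac k ((c2 : ℤ) * k + f2) * hrefl
  · have harg : Real.pi * ((((c1 : ℝ) * k + f1) + k) / k) =
        Real.pi * f1 / k + (c1 + 1 : ℕ) * Real.pi := by
      push_cast
      field_simp
      ring
    rw [harg, Real.sin_add_nat_mul_pi, abs_mul, abs_pow, abs_neg, abs_one, one_pow, one_mul,
      abs_of_pos hsin]
end

section
/- Let k ≥ 1, m ≥ 2, and s ≥ 1 be integers. Then for every real number c: f_k(c, m) · f_k(−c−k, s+1) = (−1)^{s−1} · f_k(c + (s−1)·k, m+s−1). -/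
/-- A product of `t + p` descending steps of size `k` starting at `c + t k` splits at `c`. -/
theorem fk_shift (k t p : ℕ) (c : ℝ) :
    fk k (c + t * k) (t + p + 2) = fk k (-c - k) (t + 2) * (-1) ^ t * fk k c (p + 2) := by
  simp only [fk_add_two]
  rw [Finset.prod_range_add, ← Finset.prod_range_reflect]
  congr 1
  · rw [← Finset.card_range t, ← Finset.prod_const, Finset.card_range,
      ← Finset.prod_mul_distrib]
    refine Finset.prod_congr rfl fun j hj => ?_
    have hjt : j + 1 ≤ t := Finset.mem_range.mp hj
    rw [Nat.sub_sub, Nat.cast_sub (by omega)]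
    push_cast
    ring
  · refine Finset.prod_congr rfl fun j _ => ?_
    push_cast
    ring

/-- the merging identity
`f_k(c,m) · f_k(-c-k, s+1) = (-1)^{s-1} · f_k(c + (s-1)k, m+s-1)`. -/
theorem fk_merge (k m s : ℕ) (hk : 1 ≤ k) (hm : 2 ≤ m) (hs : 1 ≤ s) (c : ℝ) :
    fk k c m * fk k (-c - k) (s + 1) =
      (-1 : ℝ) ^ (s - 1) * fk k (c + ((s : ℝ) - 1) * k) (m + s - 1) := by
  obtain ⟨p, rfl⟩ := Nat.exists_eq_add_of_le' hm
  obtain ⟨t, rfl⟩ := Nat.exists_eq_add_of_le' hs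
  have hsq : ((-1 : ℝ) ^ t) * (-1) ^ t = 1 := by
    rw [← mul_pow]
    simp
  have hidx : p + 2 + (t + 1) - 1 = t + p + 2 := by omega
  have hshift : c + (((t + 1 : ℕ) : ℝ) - 1) * k = c + t * k := by
    push_cast
    ring
  rw [hidx, hshift, fk_shift, Nat.add_sub_cancel]
  linear_combination (-(fk k c (p + 2) * fk k (-c - k) (t + 2))) * hsq
end
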